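/- Let φ(z) = |z|² and for ψ ∈ C_0^∞(ℂ) let ∂̄*_φψ = (-1)^k e^{φ}∂^k(ψ e^{-φ}). Then for every ψ ∈ C_0^∞(ℂ), ⟨ψ, ∂̄^k(∂̄*_φ ψ) − ∂̄*_φ(∂̄^k ψ)⟩_φ = Σ_{j=0}^{k-1} (k!)²/((j!)² (k−j)!) · ‖∂̄^j ψ‖²_φ; in particular this quantity is ≥ k! ‖ψ‖²_φ. -/

import Mathlib

open MeasureTheory Complex Finset

noncomputable section

/-- Wirtinger derivative ∂ = (1/2)(∂/∂x − i ∂/∂y). -/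
def dz (f : ℂ → ℂ) : ℂ → ℂ := fun z =>
  (1/2 : ℂ) * (fderiv ℝ f z 1 - Complex.I * fderiv ℝ f z Complex.I)

/-- Wirtinger derivative ∂̄ = (1/2)(∂/∂x + i ∂/∂y). -/
def dzbar (f : ℂ → ℂ) : ℂ → ℂ := fun z =>
  (1/2 : ℂ) * (fderiv ℝ f z 1 + Complex.I * fderiv ℝ f z Complex.I)

/-- Weighted inner product ⟨f,g⟩_φ = ∫ conj f · g · e^{-φ}. -/
def wip (φ : ℂ → ℝ) (f g : ℂ → ℂ) : ℂ :=
  ∫ z : ℂ, (starRingEnd ℂ) (f z) * g z * (Real.exp (-(φ z)) : ℂ)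

/-- Weighted squared L² norm ‖f‖²_φ. -/
def wnorm (φ : ℂ → ℝ) (f : ℂ → ℂ) : ℝ :=
  ∫ z : ℂ, ‖f z‖ ^ 2 * Real.exp (-(φ z))

/-- Formal adjoint of ∂̄^k : ψ ↦ (−1)^k e^{φ} ∂^k(ψ e^{-φ}). -/
def dbarStar (k : ℕ) (φ : ℂ → ℝ) (ψ : ℂ → ℂ) : ℂ → ℂ := fun z =>
  (-1 : ℂ) ^ k * (Real.exp (φ z) : ℂ) *
    dz^[k] (fun w => ψ w * (Real.exp (-(φ w)) : ℂ)) z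

/-- Formal adjoint of ∂^k : ψ ↦ (−1)^k e^{φ} ∂̄^k(ψ e^{-φ}). -/
def dStar (k : ℕ) (φ : ℂ → ℝ) (ψ : ℂ → ℂ) : ℂ → ℂ := fun z =>
  (-1 : ℂ) ^ k * (Real.exp (φ z) : ℂ) *
    dzbar^[k] (fun w => ψ w * (Real.exp (-(φ w)) : ℂ)) z

/-- R = ∂^k ∂̄^k. -/
def Rop (k : ℕ) (ψ : ℂ → ℂ) : ℂ → ℂ := dz^[k] (dzbar^[k] ψ)

/-- Formal adjoint of R : ψ ↦ e^{φ} ∂^k ∂̄^k(ψ e^{-φ}). -/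
def RStar (k : ℕ) (φ : ℂ → ℝ) (ψ : ℂ → ℂ) : ℂ → ℂ := fun z =>
  (Real.exp (φ z) : ℂ) *
    dz^[k] (dzbar^[k] (fun w => ψ w * (Real.exp (-(φ w)) : ℂ))) z

/-! ### Weyl algebra normal ordering -/

theorem weyl_comm {R : Type*} [Ring R] {D A : R} (h : D * A = A * D + 1) (n : ℕ) :
    D * A ^ n = A ^ n * D + n • A ^ (n - 1) := by
  induction n with
  | zero => simp
  | succ n ih =>
    rw [pow_succ, ← mul_assoc, ih, add_mul, mul_assoc, h, mul_add, ← mul_assoc, mul_one]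
    rcases n with _ | n
    · simp
    · simp only [Nat.add_sub_cancel, smul_mul_assoc, ← pow_succ]
      rw [add_assoc, ← succ_nsmul']

theorem weyl_normal {R : Type*} [Ring R] {D A : R} (h : D * A = A * D + 1) (n m : ℕ) :
    D ^ m * A ^ n = ∑ j ∈ Finset.range (m + 1),
      (m.choose j) • (n.descFactorial j) • (A ^ (n - j) * D ^ (m - j)) := by
  induction m with
  | zero => simp
  | succ m ih =>
    set S : ℕ → R := fun j => (n.descFactorial j) • (A ^ (n - j) * D ^ (m + 1 - j)) with hS
    have h1 : D ^ (m + 1) * A ^ n = ∑ j ∈ Finset.range (m + 1), (m.choose j) • S j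
        + ∑ j ∈ Finset.range (m + 1), (m.choose j) • S (j + 1) := by
      rw [pow_succ', mul_assoc, ih, Finset.mul_sum, ← Finset.sum_add_distrib]
      refine Finset.sum_congr rfl fun j hj => ?_
      have hj' : j ≤ m := by simpa [Nat.lt_succ_iff] using hj
      rw [← smul_add, mul_smul_comm, mul_smul_comm, ← mul_assoc, weyl_comm h, add_mul, mul_assoc,
        ← pow_succ', smul_add]
      simp only [hS]
      have e1 : m - j + 1 = m + 1 - j := by omega
      have e2 : n - j - 1 = n - (j + 1) := by omega
      have e3 : m + 1 - (j + 1) = m - j := by omega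
      rw [e1, e2, e3, Nat.descFactorial_succ, smul_mul_assoc, smul_smul (n.descFactorial j) (n - j),
        mul_comm (n - j)]
    have h2 : ∑ j ∈ Finset.range (m + 1), (m.choose j) • S j
        = ∑ j ∈ Finset.range (m + 1), (m.choose (j + 1)) • S (j + 1) + S 0 := by
      have a := Finset.sum_range_succ (fun j => (m.choose j) • S j) (m + 1)
      rw [Finset.sum_range_succ' (fun j => (m.choose j) • S j) (m + 1)] at a
      simpa using a.symm
    rw [h1, h2, Finset.sum_range_succ' _ (m + 1)]
    simp only [Nat.choose_succ_succ, add_smul, Finset.sum_add_distrib]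
    simp only [hS, Nat.choose_zero_right, one_smul]
    abel

theorem weyl_diag {R : Type*} [Ring R] {D A : R} (h : D * A = A * D + 1) (k : ℕ) :
    D ^ k * A ^ k = ∑ j ∈ Finset.range (k + 1),
      (k.choose j * k.descFactorial (k - j)) • (A ^ j * D ^ j) := by
  rw [weyl_normal h k k, ← Finset.sum_range_reflect]
  refine Finset.sum_congr rfl fun j hj => ?_
  have hj' : j ≤ k := by simpa [Nat.lt_succ_iff] using hj
  have e1 : k + 1 - 1 - j = k - j := by omega
  rw [e1, Nat.choose_symm hj', smul_smul, Nat.sub_sub_self hj']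

theorem weyl_coeff {k j : ℕ} (hj : j ≤ k) :
    ((k.choose j * k.descFactorial (k - j) : ℕ) : ℝ)
      = (k.factorial : ℝ) ^ 2 / ((j.factorial : ℝ) ^ 2 * ((k - j).factorial : ℝ)) := by
  have h1 := Nat.choose_mul_factorial_mul_factorial hj
  have h2 := Nat.factorial_mul_descFactorial (n := k) (k := k - j) (Nat.sub_le _ _)
  rw [Nat.sub_sub_self hj] at h2
  have h1' : (k.choose j : ℝ) * j.factorial * (k - j).factorial = k.factorial := by exact_mod_cast h1
  have h2' : (j.factorial : ℝ) * k.descFactorial (k - j) = k.factorial := by exact_mod_cast h2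
  have p1 : (j.factorial : ℝ) ≠ 0 := by positivity
  have p2 : ((k - j).factorial : ℝ) ≠ 0 := by positivity
  rw [eq_div_iff (by positivity), sq (k.factorial : ℝ)]
  nth_rw 1 [← h1']
  rw [← h2']
  push_cast
  ring

/-! ### Calculus of Wirtinger derivatives -/

/-- Test functions on the complex plane. -/
def TestV : Submodule ℂ (ℂ → ℂ) where
  carrier := {f | ContDiff ℝ (⊤ : ℕ∞) f ∧ HasCompactSupport f}
  add_mem' := fun ha hb => ⟨ha.1.add hb.1, ha.2.add hb.2⟩
  zero_mem' := ⟨contDiff_const, HasCompactSupport.zero⟩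
  smul_mem' := fun c f hf => ⟨contDiff_const.smul hf.1,
    hf.2.comp_left (g := fun x => c • x) (by simp)⟩

theorem TestV_diff (f : TestV) (z : ℂ) : DifferentiableAt ℝ f.1 z :=
  (f.2.1.differentiable (by simp)) z

theorem cd_fderiv {f : ℂ → ℂ} (hf : ContDiff ℝ (⊤ : ℕ∞) f) (v : ℂ) :
    ContDiff ℝ (⊤ : ℕ∞) (fun z => fderiv ℝ f z v) :=
  (hf.fderiv_right (m := (⊤ : ℕ∞)) (by simp)).clm_apply contDiff_const

theorem dz_mem {f : ℂ → ℂ} (hf : f ∈ TestV) : dz f ∈ TestV := by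
  refine ⟨contDiff_const.mul ((cd_fderiv hf.1 1).sub (contDiff_const.mul (cd_fderiv hf.1 I))), ?_⟩
  have h : HasCompactSupport (fderiv ℝ f) := hf.2.fderiv (𝕜 := ℝ)
  exact h.comp_left (g := fun L : ℂ →L[ℝ] ℂ => (1/2 : ℂ) * (L 1 - I * L I)) (by simp)

theorem dzbar_mem {f : ℂ → ℂ} (hf : f ∈ TestV) : dzbar f ∈ TestV := by
  refine ⟨contDiff_const.mul ((cd_fderiv hf.1 1).add (contDiff_const.mul (cd_fderiv hf.1 I))), ?_⟩
  have h : HasCompactSupport (fderiv ℝ f) := hf.2.fderiv (𝕜 := ℝ)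
  exact h.comp_left (g := fun L : ℂ →L[ℝ] ℂ => (1/2 : ℂ) * (L 1 + I * L I)) (by simp)

theorem dz_mul {f g : ℂ → ℂ} {z : ℂ} (hf : DifferentiableAt ℝ f z) (hg : DifferentiableAt ℝ g z) :
    dz (fun w => f w * g w) z = dz f z * g z + f z * dz g z := by
  simp only [dz, fderiv_fun_mul hf hg, _root_.add_apply,
    _root_.smul_apply, smul_eq_mul]
  ring

theorem dzbar_mul {f g : ℂ → ℂ} {z : ℂ} (hf : DifferentiableAt ℝ f z)
    (hg : DifferentiableAt ℝ g z) :
    dzbar (fun w => f w * g w) z = dzbar f z * g z + f z * dzbar g z := by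
  simp only [dzbar, fderiv_fun_mul hf hg, _root_.add_apply,
    _root_.smul_apply, smul_eq_mul]
  ring

theorem fderiv_conj' (z : ℂ) :
    HasFDerivAt (fun w : ℂ => (starRingEnd ℂ) w) (conjCLE : ℂ →L[ℝ] ℂ) z :=
  (conjCLE : ℂ →L[ℝ] ℂ).hasFDerivAt

theorem dzbar_conj (z : ℂ) : dzbar (fun w => (starRingEnd ℂ) w) z = 1 := by
  simp only [dzbar, (fderiv_conj' z).fderiv]
  simp
  norm_num

theorem dz_conj_comp {f : ℂ → ℂ} {z : ℂ} (hf : DifferentiableAt ℝ f z) :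
    dz (fun w => (starRingEnd ℂ) (f w)) z = (starRingEnd ℂ) (dzbar f z) := by
  have h : HasFDerivAt (fun w => (starRingEnd ℂ) (f w))
      ((conjCLE : ℂ →L[ℝ] ℂ).comp (fderiv ℝ f z)) z :=
    (fderiv_conj' (f z)).comp z hf.hasFDerivAt
  simp only [dz, dzbar, h.fderiv]
  simp [Complex.conj_ofNat]
  ring

/-- The Gaussian weight. -/
def gw (z : ℂ) : ℂ := (Real.exp (-(Complex.normSq z)) : ℂ)

theorem gw_eq (z : ℂ) : gw z = Complex.exp (-(z * (starRingEnd ℂ) z)) := by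
  simp [gw, Complex.mul_conj]

theorem gw_hasFDerivAt (z : ℂ) : HasFDerivAt gw
    (Complex.exp (-(z * (starRingEnd ℂ) z)) •
      (-(z • (conjCLE : ℂ →L[ℝ] ℂ) + (starRingEnd ℂ) z • ContinuousLinearMap.id ℝ ℂ))) z := by
  have h : gw = fun z => Complex.exp (-(z * (starRingEnd ℂ) z)) := funext gw_eq
  rw [h]
  exact (((hasFDerivAt_id z).mul (fderiv_conj' z)).neg).cexp

theorem gw_contDiff : ContDiff ℝ (⊤ : ℕ∞) gw := by
  have h : gw = fun z => Complex.exp (-(z * (starRingEnd ℂ) z)) := funext gw_eq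
  rw [h]
  exact ((contDiff_id.mul (conjCLE : ℂ →L[ℝ] ℂ).contDiff).neg).cexp

theorem dz_gw (z : ℂ) : dz gw z = -((starRingEnd ℂ) z) * gw z := by
  simp only [dz, (gw_hasFDerivAt z).fderiv, gw_eq]
  simp
  ring_nf
  simp
  ring

theorem dz_dzbar_comm {f : ℂ → ℂ} (hf : ContDiff ℝ (⊤ : ℕ∞) f) (z : ℂ) :
    dzbar (dz f) z = dz (dzbar f) z := by
  have hs : IsSymmSndFDerivAt ℝ f z :=
    (hf.contDiffAt (x := z)).isSymmSndFDerivAt 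
      (by simpa using WithTop.coe_le_coe.2 (le_top : (2 : ℕ∞) ≤ ⊤))
  have hd : ∀ v, DifferentiableAt ℝ (fun w => fderiv ℝ f w v) z := fun v =>
    ((cd_fderiv hf v).differentiable (by simp)) z
  have hF : DifferentiableAt ℝ (fderiv ℝ f) z :=
    ((hf.fderiv_right (m := (⊤ : ℕ∞)) (by simp)).differentiable (by simp)) z
  have h2 : ∀ v w, fderiv ℝ (fun x => fderiv ℝ f x v) z w = fderiv ℝ (fderiv ℝ f) z w v := by
    intro v w
    rw [fderiv_clm_apply hF (differentiableAt_const v)]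
    simp
  have e1 : ∀ v, fderiv ℝ (dz f) z v = (1/2 : ℂ) * (fderiv ℝ (fderiv ℝ f) z v 1
      - I * fderiv ℝ (fderiv ℝ f) z v I) := by
    intro v
    have := (((hd 1).hasFDerivAt.sub ((hd I).hasFDerivAt.const_mul I)).const_mul (1/2 : ℂ)).fderiv
    have h3 : fderiv ℝ (dz f) z = _ := this
    rw [h3]
    simp [h2]
  have e2 : ∀ v, fderiv ℝ (dzbar f) z v = (1/2 : ℂ) * (fderiv ℝ (fderiv ℝ f) z v 1
      + I * fderiv ℝ (fderiv ℝ f) z v I) := by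
    intro v
    have := (((hd 1).hasFDerivAt.add ((hd I).hasFDerivAt.const_mul I)).const_mul (1/2 : ℂ)).fderiv
    have h3 : fderiv ℝ (dzbar f) z = _ := this
    rw [h3]
    simp [h2, mul_add]
  simp only [dzbar, dz] at e1 e2 ⊢
  rw [e1, e1, e2, e2, hs.eq 1 I]
  ring

/-! ### Operators on test functions -/

/-- The operator `∂̄` on test functions. -/
def Dop : Module.End ℂ TestV where
  toFun f := ⟨dzbar f.1, dzbar_mem f.2⟩
  map_add' f g := by
    ext z
    have h : fderiv ℝ (f.1 + g.1) z = fderiv ℝ f.1 z + fderiv ℝ g.1 z :=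
      fderiv_add (TestV_diff f z) (TestV_diff g z)
    simp only [dzbar, Submodule.coe_add, h, Pi.add_apply, _root_.add_apply]
    ring
  map_smul' c f := by
    ext z
    have h : fderiv ℝ (c • f.1) z = c • fderiv ℝ f.1 z := fderiv_const_smul (TestV_diff f z) c
    simp only [dzbar, Submodule.coe_smul, h, Pi.smul_apply, _root_.smul_apply,
      smul_eq_mul, RingHom.id_apply]
    ring

theorem conj_mul_mem {f : ℂ → ℂ} (hf : f ∈ TestV) : (fun z => (starRingEnd ℂ) z * f z) ∈ TestV :=
  ⟨(conjCLE : ℂ →L[ℝ] ℂ).contDiff.mul hf.1, hf.2.mul_left⟩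

/-- The adjoint operator `f ↦ z̄ f - ∂ f` on test functions. -/
def Aop : Module.End ℂ TestV where
  toFun f := ⟨fun z => (starRingEnd ℂ) z * f.1 z - dz f.1 z,
    TestV.sub_mem (conj_mul_mem f.2) (dz_mem f.2)⟩
  map_add' f g := by
    ext z
    have h : fderiv ℝ (f.1 + g.1) z = fderiv ℝ f.1 z + fderiv ℝ g.1 z :=
      fderiv_add (TestV_diff f z) (TestV_diff g z)
    simp only [dz, Submodule.coe_add, h, Pi.add_apply, _root_.add_apply]
    ring
  map_smul' c f := by
    ext z
    have h : fderiv ℝ (c • f.1) z = c • fderiv ℝ f.1 z := fderiv_const_smul (TestV_diff f z) c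
    simp only [dz, Submodule.coe_smul, h, Pi.smul_apply, _root_.smul_apply,
      smul_eq_mul, RingHom.id_apply]
    ring

theorem Dop_coe (f : TestV) : (Dop f).1 = dzbar f.1 := rfl

theorem Aop_coe (f : TestV) : (Aop f).1 = fun z => (starRingEnd ℂ) z * f.1 z - dz f.1 z := rfl

theorem Dop_Aop : Dop * Aop = Aop * Dop + 1 := by
  ext f z
  have hm := conj_mul_mem f.2
  have hd : DifferentiableAt ℝ (fun w => (starRingEnd ℂ) w * f.1 w) z := TestV_diff ⟨_, hm⟩ z
  have hd2 : DifferentiableAt ℝ (dz f.1) z := TestV_diff ⟨_, dz_mem f.2⟩ z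
  have h1 : dzbar (fun z => (starRingEnd ℂ) z * f.1 z - dz f.1 z) z
      = dzbar (fun z => (starRingEnd ℂ) z * f.1 z) z - dzbar (dz f.1) z := by
    have h : fderiv ℝ (fun z => (starRingEnd ℂ) z * f.1 z - dz f.1 z) z
      = fderiv ℝ (fun z => (starRingEnd ℂ) z * f.1 z) z - fderiv ℝ (dz f.1) z :=
      (hd.hasFDerivAt.sub hd2.hasFDerivAt).fderiv
    simp only [dzbar, h, _root_.sub_apply]
    ring
  have h2 := dzbar_mul (fderiv_conj' z).differentiableAt (TestV_diff f z)
  rw [dzbar_conj] at h2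
  change dzbar (fun z => (starRingEnd ℂ) z * f.1 z - dz f.1 z) z
    = ((starRingEnd ℂ) z * dzbar f.1 z - dz (dzbar f.1) z) + f.1 z
  rw [h1, h2, dz_dzbar_comm f.2.1]
  ring

theorem Dop_pow_coe (k : ℕ) (f : TestV) : ((Dop ^ k) f).1 = dzbar^[k] f.1 := by
  induction k with
  | zero => simp
  | succ k ih =>
    rw [pow_succ', Module.End.mul_apply, Dop_coe, ih, Function.iterate_succ_apply']

theorem dz_mul_gw (f : TestV) : dz (fun w => f.1 w * gw w) = fun w => -((Aop f).1 w) * gw w := by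
  ext z
  rw [dz_mul (TestV_diff f z) (gw_hasFDerivAt z).differentiableAt, dz_gw, Aop_coe]
  ring

theorem dz_const_mul (c : ℂ) {f : ℂ → ℂ} (hf : Differentiable ℝ f) :
    dz (fun w => c * f w) = fun w => c * dz f w := by
  ext z
  rw [dz_mul (differentiableAt_const c) (hf z)]
  simp [dz]

theorem dz_iter_gw (k : ℕ) (f : TestV) :
    dz^[k] (fun w => f.1 w * gw w) = fun w => (-1) ^ k * (((Aop ^ k) f).1 w * gw w) := by
  induction k with
  | zero => simp
  | succ k ih =>
    rw [Function.iterate_succ_apply', ih, dz_const_mul, dz_mul_gw, pow_succ' Aop,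
      Module.End.mul_apply]
    · ext z; ring
    · exact fun z => (TestV_diff _ z).mul (gw_hasFDerivAt z).differentiableAt

theorem dbarStar_coe (k : ℕ) (f : TestV) :
    dbarStar k (fun z => Complex.normSq z) f.1 = ((Aop ^ k) f).1 := by
  ext z
  have h := congrFun (dz_iter_gw k f) z
  simp only [gw] at h
  simp only [dbarStar, h]
  have h1 : ((-1 : ℂ) ^ k) * (-1) ^ k = 1 := by rw [← mul_pow]; simp
  have h2 : (Real.exp (normSq z) : ℂ) * (Real.exp (-normSq z) : ℂ) = 1 := by
    rw [← Complex.ofReal_mul, ← Real.exp_add]; simp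
  linear_combination (((Aop ^ k) f).1 z) * (h1 * (Real.exp (normSq z) : ℂ) *
    (Real.exp (-normSq z) : ℂ) + h2)

/-! ### Integration -/

theorem integral_fderiv_zero (F : TestV) (v : ℂ) : ∫ z, fderiv ℝ F.1 z v = 0 := by
  have hi : Integrable (fun z => fderiv ℝ F.1 z v) :=
    (cd_fderiv F.2.1 v).continuous.integrable_of_hasCompactSupport (F.2.2.fderiv_apply (𝕜 := ℝ) v)
  have h := integral_mul_fderiv_eq_neg_fderiv_mul_of_integrable (𝕜 := ℂ) (μ := (volume : Measure ℂ))
    (f := fun _ : ℂ => (1 : ℂ)) (g := F.1) (v := v) (by simp)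
    (by simpa using hi)
    (by simpa using F.2.1.continuous.integrable_of_hasCompactSupport F.2.2)
    (fun x _ => differentiableAt_const _) (fun x _ => TestV_diff F x)
  simpa using h

theorem integral_dz_zero (F : TestV) : ∫ z, dz F.1 z = 0 := by
  have hi : ∀ v, Integrable (fun z => fderiv ℝ F.1 z v) := fun v =>
    (cd_fderiv F.2.1 v).continuous.integrable_of_hasCompactSupport (F.2.2.fderiv_apply (𝕜 := ℝ) v)
  simp only [dz]
  rw [integral_const_mul, integral_sub (hi 1) ((hi I).const_mul I), integral_const_mul,
    integral_fderiv_zero, integral_fderiv_zero]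
  simp

theorem wip_mem (f g : TestV) : (fun z => (starRingEnd ℂ) (f.1 z) * g.1 z * gw z) ∈ TestV :=
  ⟨(((conjCLE : ℂ →L[ℝ] ℂ).contDiff.comp f.2.1).mul g.2.1).mul gw_contDiff,
    (g.2.2.mul_left).mul_right⟩

theorem wip_integrable (f g : TestV) :
    Integrable (fun z => (starRingEnd ℂ) (f.1 z) * g.1 z * gw z) :=
  (wip_mem f g).1.continuous.integrable_of_hasCompactSupport (wip_mem f g).2

/-- The weighted inner product as a linear functional in the second variable. -/
def wipL (f : TestV) : TestV →ₗ[ℂ] ℂ where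
  toFun g := ∫ z, (starRingEnd ℂ) (f.1 z) * g.1 z * gw z
  map_add' g h := by
    rw [← integral_add (wip_integrable f g) (wip_integrable f h)]
    congr 1
    ext z
    simp only [Submodule.coe_add, Pi.add_apply]
    ring
  map_smul' c g := by
    rw [RingHom.id_apply, smul_eq_mul, ← integral_const_mul]
    congr 1
    ext z
    simp only [Submodule.coe_smul, Pi.smul_apply, smul_eq_mul]
    ring

theorem wipL_eq (f g : TestV) : wip (fun z => Complex.normSq z) f.1 g.1 = wipL f g := rfl

theorem wipL_adj (f g : TestV) : wipL f (Aop g) = wipL (Dop f) g := by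
  have h := integral_dz_zero ⟨_, wip_mem f g⟩
  have e : ∀ z, dz (fun z => (starRingEnd ℂ) (f.1 z) * g.1 z * gw z) z
      = (starRingEnd ℂ) ((Dop f).1 z) * g.1 z * gw z
        - (starRingEnd ℂ) (f.1 z) * (Aop g).1 z * gw z := by
    intro z
    have hc : DifferentiableAt ℝ (fun w => (starRingEnd ℂ) (f.1 w)) z :=
      ((fderiv_conj' (f.1 z)).comp z (TestV_diff f z).hasFDerivAt).differentiableAt
    rw [dz_mul (hc.fun_mul (TestV_diff g z)) (gw_hasFDerivAt z).differentiableAt, dz_mul hc (TestV_diff g z),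
      dz_conj_comp (TestV_diff f z), dz_gw, Aop_coe, Dop_coe]
    ring
  simp only [e] at h
  rw [integral_sub (wip_integrable _ _) (wip_integrable _ _), sub_eq_zero] at h
  exact h.symm

theorem wipL_adj_pow (j : ℕ) (f g : TestV) : wipL f ((Aop ^ j) g) = wipL ((Dop ^ j) f) g := by
  induction j generalizing f with
  | zero => simp
  | succ j ih =>
    rw [pow_succ', Module.End.mul_apply, wipL_adj, ih, pow_succ, Module.End.mul_apply]

theorem wipL_self (f : TestV) : wipL f f = (wnorm (fun z => Complex.normSq z) f.1 : ℂ) := by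
  rw [wnorm, ← integral_complex_ofReal]
  change ∫ z, (starRingEnd ℂ) (f.1 z) * f.1 z * gw z = _
  congr 1
  ext z
  rw [Complex.conj_mul', gw]
  push_cast
  rfl

theorem wnorm_nonneg (f : ℂ → ℂ) : 0 ≤ wnorm (fun z => Complex.normSq z) f :=
  integral_nonneg fun z => by positivity


theorem comm_dzbar_dbarStar (k : ℕ) (hk : 1 ≤ k) (ψ : ℂ → ℂ)
    (hψ : ContDiff ℝ (⊤ : ℕ∞) ψ) (hψc : HasCompactSupport ψ) :
    wip (fun z => Complex.normSq z) ψ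
        (fun z => dzbar^[k] (dbarStar k (fun z => Complex.normSq z) ψ) z - dbarStar k (fun z => Complex.normSq z) (dzbar^[k] ψ) z)
      = ((∑ j ∈ Finset.range k,
          (k.factorial : ℝ) ^ 2 / ((j.factorial : ℝ) ^ 2 * ((k - j).factorial : ℝ)) *
            wnorm (fun z => Complex.normSq z) (dzbar^[j] ψ) : ℝ) : ℂ) ∧
    (k.factorial : ℝ) * wnorm (fun z => Complex.normSq z) ψ ≤
      ∑ j ∈ Finset.range k,
        (k.factorial : ℝ) ^ 2 / ((j.factorial : ℝ) ^ 2 * ((k - j).factorial : ℝ)) *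
          wnorm (fun z => Complex.normSq z) (dzbar^[j] ψ) := by
  constructor
  · let f : TestV := ⟨ψ, hψ, hψc⟩
    have e1 : (fun z => dzbar^[k] (dbarStar k (fun z => Complex.normSq z) ψ) z
        - dbarStar k (fun z => Complex.normSq z) (dzbar^[k] ψ) z)
        = ((Dop ^ k * Aop ^ k - Aop ^ k * Dop ^ k) f).1 := by
      have a1 : dbarStar k (fun z => Complex.normSq z) ψ = ((Aop ^ k) f).1 := dbarStar_coe k f
      have a2 : dzbar^[k] ψ = ((Dop ^ k) f).1 := (Dop_pow_coe k f).symm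
      rw [a1, a2, dbarStar_coe, ← Dop_pow_coe]
      rfl
    have e2 : Dop ^ k * Aop ^ k - Aop ^ k * Dop ^ k = ∑ j ∈ Finset.range k,
        (k.choose j * k.descFactorial (k - j)) • (Aop ^ j * Dop ^ j) := by
      rw [weyl_diag (R := Module.End ℂ TestV) Dop_Aop, Finset.sum_range_succ, Nat.choose_self,
        Nat.sub_self, Nat.descFactorial_zero, mul_one, one_smul]
      exact add_sub_cancel_right (G := Module.End ℂ TestV) _ _
    rw [e1, e2]
    have e3 : wip (fun z => Complex.normSq z) ψ = wip (fun z => Complex.normSq z) f.1 := rfl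
    rw [e3, wipL_eq, LinearMap.sum_apply, map_sum, Complex.ofReal_sum]
    refine Finset.sum_congr rfl fun j hj => ?_
    rw [LinearMap.smul_apply, map_nsmul, Module.End.mul_apply, wipL_adj_pow, wipL_self,
      Dop_pow_coe, ← weyl_coeff (Finset.mem_range.1 hj).le, nsmul_eq_mul]
    push_cast
    rfl
  · have h := Finset.single_le_sum (f := fun j => (k.factorial : ℝ) ^ 2 /
        ((j.factorial : ℝ) ^ 2 * ((k - j).factorial : ℝ)) *
          wnorm (fun z => Complex.normSq z) (dzbar^[j] ψ)) (s := Finset.range k)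
      (fun j _ => mul_nonneg (by positivity) (wnorm_nonneg _)) (Finset.mem_range.2 hk)
    refine le_trans (le_of_eq ?_) h
    have p : (k.factorial : ℝ) ≠ 0 := by positivity
    simp only [Nat.factorial_zero, Nat.sub_zero, Function.iterate_zero, id]
    congr 1
    field_simp
    simp

end
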